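/- arXiv:2108.03848 — 13 statements merged into one kernel-verified Lean document; each statement's English description precedes it below -/
import Mathlib

section
/- Let q be a prime power, let d and k be integers with d > 0 and k ≥ 0, and let β, δ be elements of the finite field F_{q²} with β^{q+1} = 1 and δ^q ≠ δ (i.e. δ does not lie in the subfield F_q). Then the map f : F_{q²} → F_{q²} defined by f(x) = x^{d+k(q+1)} · ((δ·x^{q−1} − β·δ^q)^d − δ·(x^{q−1} − β)^d) is a bijection of F_{q²} if and only if gcd(d·(d+2k), q−1) = 1. -/
theorem exists_ringHom_eq_pow {p e : ℕ} (hp : p.Prime) {F : Type*} [Field F] [Fintype F]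
    {n : ℕ} (hF : Fintype.card F = p ^ n) : ∃ σ : F →+* F, ∀ x, σ x = x ^ p ^ e := by
  obtain ⟨r, hr⟩ := CharP.exists F
  obtain ⟨m, hrp, hm⟩ := FiniteField.card F r
  have hrdvd : r ∣ p ^ n := by
    rw [← hF, hm]
    exact dvd_pow_self r m.ne_zero
  have hrp_eq : r = p := (Nat.prime_dvd_prime_iff_eq hrp hp).1 (hrp.dvd_of_dvd_pow hrdvd)
  subst hrp_eq
  have : Fact r.Prime := ⟨hp⟩
  exact ⟨iterateFrobenius F r e, fun x => iterateFrobenius_def r e x⟩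

theorem eq_one_of_pow_eq_one_of_gcd_eq_one {M : Type*} [Monoid M] {m n : ℕ}
    (h : Nat.gcd m n = 1) {t : M} (hm : t ^ m = 1) (hn : t ^ n = 1) : t = 1 := by
  have := Nat.dvd_gcd (orderOf_dvd_of_pow_eq_one hm) (orderOf_dvd_of_pow_eq_one hn)
  rw [h, Nat.dvd_one] at this
  exact orderOf_eq_one_iff.1 this

theorem gcd_eq_one_of_forall_pow_eq_one {F : Type*} [Field F] [Fintype F] {m n : ℕ}
    (hn : n ∣ Fintype.card F - 1)
    (h : ∀ t : F, t ^ m = 1 → t ^ n = 1 → t = 1) : Nat.gcd m n = 1 := by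
  obtain ⟨w, hw⟩ := IsCyclic.exists_ofOrder_eq_natCard (α := Fˣ)
  rw [Nat.card_units, Nat.card_eq_fintype_card] at hw
  obtain ⟨c, hc⟩ := (Nat.gcd_dvd_right m n).trans hn
  have hpos : 0 < orderOf w := orderOf_pos w
  rw [hw, hc] at hpos
  have hg : (w ^ c) ^ Nat.gcd m n = 1 := by
    rw [← pow_mul, mul_comm, ← hc, ← hw, pow_orderOf_eq_one]
  have key : ∀ j, Nat.gcd m n ∣ j → ((w ^ c : Fˣ) : F) ^ j = 1 := by
    rintro j ⟨i, rfl⟩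
    rw [← Units.val_pow_eq_pow_val, pow_mul, hg, one_pow, Units.val_one]
  have h1 : w ^ c = 1 := Units.ext
    (h _ (key _ (Nat.gcd_dvd_left m n)) (key _ (Nat.gcd_dvd_right m n)))
  have hdvd := orderOf_dvd_of_pow_eq_one h1
  rw [hw, hc] at hdvd
  have hcpos : 0 < c := Nat.pos_of_mul_pos_left hpos
  have := Nat.le_of_dvd hcpos hdvd
  have hgpos : 0 < Nat.gcd m n := Nat.pos_of_mul_pos_right hpos
  nlinarith

theorem exists_pow_eq_of_gcd_eq_one {G : Type*} [Group G] {m n : ℕ}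
    (h : Nat.gcd m n = 1) {r : G} (hr : r ^ n = 1) :
    ∃ t : G, t ^ n = 1 ∧ t ^ m = r := by
  refine ⟨r ^ Nat.gcdA m n, ?_, ?_⟩
  · rw [← zpow_natCast, ← zpow_mul, mul_comm, zpow_mul, zpow_natCast, hr, one_zpow]
  · have hb := Nat.gcd_eq_gcd_ab m n
    rw [h] at hb
    calc (r ^ Nat.gcdA m n) ^ m = r ^ ((m : ℤ) * Nat.gcdA m n + n * Nat.gcdB m n) := by
          rw [zpow_add, zpow_mul r n, zpow_natCast r n, hr, one_zpow, mul_one, mul_comm, zpow_mul,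
            zpow_natCast]
      _ = r := by rw [← hb]; simp

section Involution

variable {F : Type*} [Field F] {σ : F →+* F} {β δ : F} {d k : ℕ}

theorem eq_zero_of_sub_mul_eq_zero {τ P Q : F} (hδ : σ δ ≠ δ) (hP : τ * σ P = P)
    (hQ : τ * σ Q = Q) (h : P - δ * Q = 0) : P = 0 ∧ Q = 0 := by
  have h2 := congrArg σ h
  rw [map_sub, map_mul, map_zero] at h2
  have h3 : (δ - σ δ) * Q = 0 := by
    linear_combination τ * h2 - h - hP + σ δ * hQ
  have hQ0 : Q = 0 := (mul_eq_zero.1 h3).resolve_left (sub_ne_zero.2 hδ.symm)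
  refine ⟨?_, hQ0⟩
  simpa [hQ0] using h

theorem neg_mul_map_left (hσ : ∀ x, σ (σ x) = x) (hβ : β * σ β = 1) (x : F) :
    -β * σ (δ * σ x - β * σ δ * x) = δ * σ x - β * σ δ * x := by
  simp only [map_sub, map_mul, hσ]
  linear_combination δ * σ x * hβ

theorem neg_mul_map_right (hσ : ∀ x, σ (σ x) = x) (hβ : β * σ β = 1) (x : F) :
    -β * σ (σ x - β * x) = σ x - β * x := by
  simp only [map_sub, map_mul, hσ]
  linear_combination σ x * hβ

theorem neg_pow_mul_map_norm_pow_mul (hσ : ∀ x, σ (σ x) = x) {u : F} (hu : -β * σ u = u) (x : F) :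
    (-β) ^ d * σ ((x * σ x) ^ k * u ^ d) = (x * σ x) ^ k * u ^ d := by
  conv_rhs => rw [← hu]
  simp only [map_mul, map_pow, hσ]
  ring

/-- The polynomial map of the theorem, in terms of the conjugation `σ`. -/
def conjMap (σ : F →+* F) (β δ : F) (d k : ℕ) (x : F) : F :=
  (x * σ x) ^ k * ((δ * σ x - β * σ δ * x) ^ d - δ * (σ x - β * x) ^ d)

theorem conjMap_mul {t : F} (ht : σ t = t) (x : F) :
    conjMap σ β δ d k (t * x) = t ^ (d + 2 * k) * conjMap σ β δ d k x := by
  have h1 : δ * (t * σ x) - β * σ δ * (t * x) = t * (δ * σ x - β * σ δ * x) := by ring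
  have h2 : t * σ x - β * (t * x) = t * (σ x - β * x) := by ring
  have h3 : t * x * (t * σ x) = t ^ 2 * (x * σ x) := by ring
  simp only [conjMap, map_mul, ht, h1, h2, h3, mul_pow, pow_add, pow_mul]
  ring

theorem conjMap_eq_conjMap (hσ : ∀ x, σ (σ x) = x) (hβ : β * σ β = 1) (hδ : σ δ ≠ δ) {x y : F}
    (h : conjMap σ β δ d k x = conjMap σ β δ d k y) :
    (x * σ x) ^ k * (δ * σ x - β * σ δ * x) ^ d = (y * σ y) ^ k * (δ * σ y - β * σ δ * y) ^ d ∧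
      (x * σ x) ^ k * (σ x - β * x) ^ d = (y * σ y) ^ k * (σ y - β * y) ^ d := by
  rw [← sub_eq_zero, ← sub_eq_zero (b := (y * σ y) ^ k * (σ y - β * y) ^ d)]
  refine eq_zero_of_sub_mul_eq_zero (σ := σ) (τ := (-β) ^ d) hδ ?_ ?_ ?_
  · rw [map_sub, mul_sub, neg_pow_mul_map_norm_pow_mul hσ (neg_mul_map_left hσ hβ x),
      neg_pow_mul_map_norm_pow_mul hσ (neg_mul_map_left hσ hβ y)]
  · rw [map_sub, mul_sub, neg_pow_mul_map_norm_pow_mul hσ (neg_mul_map_right hσ hβ x),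
      neg_pow_mul_map_norm_pow_mul hσ (neg_mul_map_right hσ hβ y)]
  · simp only [conjMap] at h
    linear_combination h

theorem eq_zero_of_conjMap_eq_zero (hσ : ∀ x, σ (σ x) = x) (hβ : β * σ β = 1) (hδ : σ δ ≠ δ)
    (hd : 0 < d) {x : F} (h : conjMap σ β δ d k x = 0) : x = 0 := by
  have h0 : conjMap σ β δ d k 0 = 0 := by simp [conjMap, hd.ne']
  obtain ⟨h1, h2⟩ := conjMap_eq_conjMap hσ hβ hδ (h.trans h0.symm)
  by_contra hx
  have hN : (x * σ x) ^ k ≠ 0 := pow_ne_zero _ (mul_ne_zero hx ((map_ne_zero σ).2 hx))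
  simp only [map_zero, mul_zero, sub_zero, zero_pow hd.ne', mul_eq_zero, hN, false_or] at h1 h2
  have h1' := eq_zero_of_pow_eq_zero h1
  have h2' := eq_zero_of_pow_eq_zero h2
  have hβ0 : β ≠ 0 := left_ne_zero_of_mul_eq_one hβ
  have : β * (δ - σ δ) * x = 0 := by linear_combination h1' - δ * h2'
  simp [hβ0, hx, sub_eq_zero, hδ.symm] at this

theorem conjMap_injective (hσ : ∀ x, σ (σ x) = x) (hβ : β * σ β = 1) (hδ : σ δ ≠ δ) (hd : 0 < d)
    (h1 : ∀ t, σ t = t → t ^ d = 1 → t = 1) (h2 : ∀ t, σ t = t → t ^ (d + 2 * k) = 1 → t = 1) :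
    Function.Injective (conjMap σ β δ d k) := by
  intro x y h
  have h0 : conjMap σ β δ d k 0 = 0 := by simp [conjMap, hd.ne']
  by_cases hx : x = 0
  · subst hx
    exact (eq_zero_of_conjMap_eq_zero hσ hβ hδ hd (h.symm.trans h0)).symm
  by_cases hy : y = 0
  · subst hy
    exact eq_zero_of_conjMap_eq_zero hσ hβ hδ hd (h.trans h0)
  have hβ0 : β ≠ 0 := left_ne_zero_of_mul_eq_one hβ
  have hNx : (x * σ x) ^ k ≠ 0 := pow_ne_zero _ (mul_ne_zero hx ((map_ne_zero σ).2 hx))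
  have hNy : (y * σ y) ^ k ≠ 0 := pow_ne_zero _ (mul_ne_zero hy ((map_ne_zero σ).2 hy))
  obtain ⟨hu, hv⟩ := conjMap_eq_conjMap hσ hβ hδ h
  have hux := neg_mul_map_left (δ := δ) hσ hβ x
  have huy := neg_mul_map_left (δ := δ) hσ hβ y
  have hvx := neg_mul_map_right hσ hβ x
  have hvy := neg_mul_map_right hσ hβ y
  have hdet : (δ * σ x - β * σ δ * x) * (σ y - β * y) - (δ * σ y - β * σ δ * y) * (σ x - β * x)
      = β * (δ - σ δ) * (σ y * x - σ x * y) := by ring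
  generalize δ * σ x - β * σ δ * x = u at *
  generalize δ * σ y - β * σ δ * y = u' at *
  generalize σ x - β * x = v at *
  generalize σ y - β * y = v' at *
  have hpow : (u * v') ^ d = (u' * v) ^ d := by
    refine mul_left_cancel₀ (mul_ne_zero hNx hNy) ?_
    rw [mul_pow, mul_pow]
    linear_combination (y * σ y) ^ k * v' ^ d * hu - (y * σ y) ^ k * u' ^ d * hv
  have hcross : u * v' = u' * v := by
    by_cases hz : u' * v = 0
    · rw [hz, zero_pow hd.ne'] at hpow
      rw [hz, eq_zero_of_pow_eq_zero hpow]
    · rw [← div_eq_one_iff_eq hz]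
      refine h1 _ ?_ (by rw [div_pow, hpow, div_self (pow_ne_zero _ hz)])
      have hz' : σ (u' * v) ≠ 0 := (map_ne_zero σ).2 hz
      rw [map_div₀, div_eq_div_iff hz' hz, map_mul, map_mul]
      refine mul_left_cancel₀ (pow_ne_zero 2 hβ0) ?_
      calc β ^ 2 * (σ u * σ v' * (u' * v)) = (-β * σ u) * (-β * σ v') * (u' * v) := by ring
        _ = (-β * σ u') * (-β * σ v) * (u * v') := by rw [hux, huy, hvx, hvy]; ring
        _ = β ^ 2 * (u * v' * (σ u' * σ v)) := by ring
  have hconj : σ y * x = σ x * y := by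
    rw [hcross, sub_self] at hdet
    simpa [hβ0, sub_eq_zero, hδ.symm] using hdet.symm
  have ht : σ (y / x) = y / x := by
    rw [map_div₀, div_eq_div_iff ((map_ne_zero σ).2 hx) hx, hconj, mul_comm]
  have hyx : y = y / x * x := (div_mul_cancel₀ y hx).symm
  have hfx : conjMap σ β δ d k x ≠ 0 := fun h' => hx (eq_zero_of_conjMap_eq_zero hσ hβ hδ hd h')
  have ht1 : y / x = 1 := by
    refine h2 _ ht (mul_right_cancel₀ hfx ?_)
    rw [← conjMap_mul ht, ← hyx, one_mul, h]
  rw [hyx, ht1, one_mul]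

theorem eq_one_of_conjMap_injective_of_pow_add (h : Function.Injective (conjMap σ β δ d k))
    {t : F} (ht : σ t = t) (htd : t ^ (d + 2 * k) = 1) : t = 1 := by
  apply h
  rw [← mul_one t, conjMap_mul ht, htd, one_mul]

theorem exists_ne_zero_neg_mul_map_eq (hσ : ∀ x, σ (σ x) = x) (hβ : β * σ β = 1) (hδ : σ δ ≠ δ) :
    ∃ γ : F, γ ≠ 0 ∧ -β * σ γ = γ := by
  by_cases h : β = 1
  · refine ⟨_, ?_, neg_mul_map_right hσ hβ δ⟩
    rwa [h, one_mul, sub_ne_zero]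
  · refine ⟨_, ?_, neg_mul_map_right hσ hβ 1⟩
    rw [map_one, mul_one, sub_ne_zero]
    exact Ne.symm h

theorem exists_conj_coordinates (hβ : β * σ β = 1) (hσ : ∀ x, σ (σ x) = x) (hδ : σ δ ≠ δ)
    {γ a b : F} (hγ : -β * σ γ = γ) (ha : σ a = a) (hb : σ b = b) :
    ∃ x : F, δ * σ x - β * σ δ * x = γ * a ∧ σ x - β * x = γ * b := by
  have hβ0 : β ≠ 0 := left_ne_zero_of_mul_eq_one hβ
  have hc : δ - σ δ ≠ 0 := sub_ne_zero.2 hδ.symm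
  have hc' : σ δ - δ ≠ 0 := sub_ne_zero.2 hδ
  have hβσ : σ β = β⁻¹ := eq_inv_of_mul_eq_one_right hβ
  have hγσ : σ γ = -γ / β := by
    rw [eq_div_iff hβ0]
    linear_combination -hγ
  have hx : σ (γ * (a - δ * b) / (β * (δ - σ δ))) = γ * (a - σ δ * b) / (δ - σ δ) := by
    simp only [map_div₀, map_mul, map_sub, ha, hb, hσ, hγσ, hβσ]
    field_simp
    ring
  refine ⟨γ * (a - δ * b) / (β * (δ - σ δ)), ?_, ?_⟩
  · rw [hx]
    field_simp
    ring
  · rw [hx]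
    field_simp
    ring

theorem eq_one_of_conjMap_injective_of_pow (hσ : ∀ x, σ (σ x) = x) (hβ : β * σ β = 1)
    (hδ : σ δ ≠ δ) (h : Function.Injective (conjMap σ β δ d k))
    (hroot : ∀ r : F, r ≠ 0 → σ r = r → ∃ t, σ t = t ∧ t ^ (d + 2 * k) = r)
    {ζ : F} (hζ : σ ζ = ζ) (hζd : ζ ^ d = 1) : ζ = 1 := by
  obtain ⟨γ, hγ0, hγ⟩ := exists_ne_zero_neg_mul_map_eq hσ hβ hδ
  obtain ⟨x, hux, hvx⟩ := exists_conj_coordinates hβ hσ hδ hγ (map_one σ) (map_one σ)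
  obtain ⟨y, huy, hvy⟩ := exists_conj_coordinates hβ hσ hδ hγ hζ (map_one σ)
  rw [mul_one] at hux hvx hvy
  have hx : x ≠ 0 := by
    rintro rfl
    simp [hγ0.symm] at hvx
  have hy : y ≠ 0 := by
    rintro rfl
    simp [hγ0.symm] at hvy
  have hNx : x * σ x ≠ 0 := mul_ne_zero hx ((map_ne_zero σ).2 hx)
  have hNy : y * σ y ≠ 0 := mul_ne_zero hy ((map_ne_zero σ).2 hy)
  obtain ⟨t, ht, htr⟩ := hroot ((x * σ x / (y * σ y)) ^ k) (pow_ne_zero _ (div_ne_zero hNx hNy))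
    (by simp only [map_pow, map_div₀, map_mul, hσ, mul_comm])
  have heq : t * y = x := by
    apply h
    rw [conjMap_mul ht, htr, conjMap, conjMap, hux, hvx, huy, hvy, mul_pow γ, hζd, mul_one,
      ← mul_assoc, ← mul_pow, div_mul_cancel₀ _ hNy]
  have ht1 : t = 1 := by
    apply mul_right_cancel₀ hγ0
    rw [← heq, map_mul, ht] at hvx
    linear_combination hvx - t * hvy
  rw [ht1, one_mul] at heq
  subst heq
  exact mul_left_cancel₀ hγ0 (by rw [← huy, hux, mul_one])

end Involution

theorem stmt_0 (p e q : ℕ) (hp : p.Prime) (he : 0 < e) (hq : q = p ^ e)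
    (F : Type*) [Field F] [Fintype F] (hF : Fintype.card F = q ^ 2)
    (d k : ℕ) (hd : 0 < d)
    (β δ : F) (hβ : β ^ (q + 1) = 1) (hδ : δ ^ q ≠ δ) :
    Function.Bijective (fun x : F =>
      x ^ (d + k * (q + 1)) *
        ((δ * x ^ (q - 1) - β * δ ^ q) ^ d - δ * (x ^ (q - 1) - β) ^ d))
      ↔ Nat.gcd (d * (d + 2 * k)) (q - 1) = 1 := by
  have hq1 : 1 < q := hq ▸ Nat.one_lt_pow he.ne' hp.one_lt
  have hsucc : q - 1 + 1 = q := Nat.sub_add_cancel hq1.le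
  obtain ⟨σ, hσq⟩ : ∃ σ : F →+* F, ∀ x, σ x = x ^ q := by
    subst hq
    exact exists_ringHom_eq_pow hp (hF.trans (pow_mul p e 2).symm)
  have hσ : ∀ x, σ (σ x) = x := fun x => by
    rw [hσq, hσq, ← pow_mul, ← pow_two, ← hF, FiniteField.pow_card]
  have hβσ : β * σ β = 1 := by rw [hσq, ← pow_succ', hβ]
  have hδσ : σ δ ≠ δ := by rwa [hσq]
  have hfix : ∀ t : F, t ≠ 0 → (σ t = t ↔ t ^ (q - 1) = 1) := fun t ht => by
    rw [hσq, ← mul_left_inj' ht (a := t ^ (q - 1)), ← pow_succ, hsucc, one_mul]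
  have hfun : (fun x : F => x ^ (d + k * (q + 1)) *
      ((δ * x ^ (q - 1) - β * δ ^ q) ^ d - δ * (x ^ (q - 1) - β) ^ d)) = conjMap σ β δ d k := by
    funext x
    have hx : σ x = x ^ (q - 1) * x := by rw [hσq, ← pow_succ, hsucc]
    have h1 : δ * σ x - β * σ δ * x = (δ * x ^ (q - 1) - β * δ ^ q) * x := by
      rw [hx, hσq δ]
      ring
    have h2 : σ x - β * x = (x ^ (q - 1) - β) * x := by
      rw [hx]
      ring
    have h3 : x * σ x = x ^ (q + 1) := by rw [hσq, ← pow_succ']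
    rw [conjMap, h1, h2, h3, pow_add, mul_comm k, pow_mul, mul_pow, mul_pow]
    ring
  have hne : ∀ {t : F} {n : ℕ}, n ≠ 0 → t ^ n = 1 → t ≠ 0 := by
    rintro t n hn h rfl
    simp [hn] at h
  rw [hfun, ← Finite.injective_iff_bijective]
  have hdvd : q - 1 ∣ Fintype.card F - 1 := by
    rw [hF]
    simpa using Nat.sub_dvd_pow_sub_pow q 1 2
  constructor
  · intro h
    have h2 : Nat.gcd (d + 2 * k) (q - 1) = 1 :=
      gcd_eq_one_of_forall_pow_eq_one hdvd fun t htn htq =>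
        eq_one_of_conjMap_injective_of_pow_add h
          ((hfix t (hne (Nat.sub_pos_of_lt hq1).ne' htq)).2 htq) htn
    refine Nat.Coprime.mul_left ?_ h2
    refine gcd_eq_one_of_forall_pow_eq_one hdvd fun t htn htq => ?_
    refine eq_one_of_conjMap_injective_of_pow hσ hβσ hδσ h ?_
      ((hfix t (hne hd.ne' htn)).2 htq) htn
    intro r hr hσr
    obtain ⟨s, hs, hsr⟩ := exists_pow_eq_of_gcd_eq_one (r := Units.mk0 r hr) h2
      (Units.ext (by simpa using (hfix r hr).1 hσr))
    refine ⟨s, (hfix _ s.ne_zero).2 ?_, ?_⟩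
    · rw [← Units.val_pow_eq_pow_val, hs, Units.val_one]
    · rw [← Units.val_pow_eq_pow_val, hsr, Units.val_mk0]
  · intro h
    refine conjMap_injective hσ hβσ hδσ hd (fun t ht htd => ?_) (fun t ht htd => ?_)
    · exact eq_one_of_pow_eq_one_of_gcd_eq_one (Nat.Coprime.coprime_mul_right h) htd
        ((hfix t (hne hd.ne' htd)).1 ht)
    · exact eq_one_of_pow_eq_one_of_gcd_eq_one (Nat.Coprime.coprime_mul_left h) htd
        ((hfix t (hne (by omega) htd)).1 ht)
end

section
/- Let q = 3^k with k ≥ 1, and let a, c be nonzero elements of the finite field F_{q²} lying in the subfield F_q (i.e. a^q = a and c^q = c). Then the map f : F_{q²} → F_{q²} defined by f(x) = x³ + a·x^{q+2} − a·x^{2q+1} + c·x^{3q} is a bijection of F_{q²} if any one of the following conditions holds: (1) c = a, a ≠ −1 and a^{(q−1)/2} = 1; (2) c = a − 1 and (−a)^{(q−1)/2} = 1; (3) c = 1 − a, a ≠ −1 and k is even; (4) c = 1. -/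
/-- In odd characteristic, an element `d` with `d ^ q = -d` and `s` with `s ^ q = s` cannot satisfy
`d ^ 2 = e * s ^ 2` for a square `e` of the field with `q` elements, unless `d = 0`. -/
lemma eq_zero_of_sq_eq_mul_sq {F : Type*} [Field F] {q : ℕ} (hodd : Odd q) (h2 : (2 : F) ≠ 0)
    {d s e : F} (hd : d ^ q = -d) (hs : s ^ q = s) (he : e ^ ((q - 1) / 2) = 1)
    (h : d ^ 2 = e * s ^ 2) : d = 0 := by
  obtain ⟨m, rfl⟩ := hodd
  rw [show (2 * m + 1 - 1) / 2 = m by omega] at he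
  have hpow : d ^ (2 * m) = s ^ (2 * m) := by
    rw [pow_mul, h, mul_pow, he, one_mul, ← pow_mul]
  by_cases hs0 : s = 0
  · subst hs0
    exact pow_eq_zero_iff (two_ne_zero) |>.mp (by simpa using h)
  · have h1 : s ^ (2 * m) = 1 := by
      rw [pow_succ] at hs
      exact mul_right_cancel₀ hs0 (by rw [hs, one_mul])
    rw [pow_succ, hpow, h1, one_mul] at hd
    have h3 : 2 * d = 0 := by linear_combination hd
    exact (mul_eq_zero.mp h3).resolve_left h2

theorem stmt_1 (k q : ℕ) (hk : 0 < k) (hq : q = 3 ^ k)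
    (F : Type*) [Field F] [Fintype F] (hF : Fintype.card F = q ^ 2)
    (a c : F) (ha : a ≠ 0) (hc : c ≠ 0) (haq : a ^ q = a) (hcq : c ^ q = c)
    (h : (c = a ∧ a ≠ -1 ∧ a ^ ((q - 1) / 2) = 1) ∨
         (c = a - 1 ∧ (-a) ^ ((q - 1) / 2) = 1) ∨
         (c = 1 - a ∧ a ≠ -1 ∧ Even k) ∨
         c = 1) :
    Function.Bijective (fun x : F =>
      x ^ 3 + a * x ^ (q + 2) - a * x ^ (2 * q + 1) + c * x ^ (3 * q)) := by
  have h3 : (3 : F) = 0 := by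
    have hcast := Nat.cast_card_eq_zero F
    rw [hF, hq] at hcast
    push_cast at hcast
    exact pow_eq_zero_iff hk.ne' |>.mp (pow_eq_zero_iff two_ne_zero |>.mp hcast)
  have : Fact (Nat.Prime 3) := ⟨Nat.prime_three⟩
  have : CharP F 3 := (CharP.charP_iff_prime_eq_zero Nat.prime_three).mpr (by exact_mod_cast h3)
  have h2 : (2 : F) ≠ 0 := fun h2 => one_ne_zero (α := F) (by linear_combination h3 - h2)
  have hodd : Odd q := hq ▸ Odd.pow (by decide)
  have hadd : ∀ x y : F, (x + y) ^ q = x ^ q + y ^ q := fun x y => by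
    rw [hq]; exact add_pow_char_pow x y 3 k
  have hsub : ∀ x y : F, (x - y) ^ q = x ^ q - y ^ q := fun x y => by
    rw [hq]; exact sub_pow_char_pow x y k
  have hqq : ∀ x : F, (x ^ q) ^ q = x := fun x => by
    rw [← pow_mul, ← sq, ← hF, FiniteField.pow_card]
  have hform : ∀ x : F, x ^ 3 + a * x ^ (q + 2) - a * x ^ (2 * q + 1) + c * x ^ (3 * q) =
      x ^ 3 + a * (x ^ q * x ^ 2) - a * ((x ^ q) ^ 2 * x) + c * (x ^ q) ^ 3 := fun x => by ring
  have hconj : ∀ x : F,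
      (x ^ 3 + a * (x ^ q * x ^ 2) - a * ((x ^ q) ^ 2 * x) + c * (x ^ q) ^ 3) ^ q =
      (x ^ q) ^ 3 + a * (x * (x ^ q) ^ 2) - a * (x ^ 2 * x ^ q) + c * x ^ 3 := fun x => by
    simp only [hadd, hsub, mul_pow, haq, hcq, pow_right_comm _ _ q, hqq]
  have hc1 : 1 + c ≠ 0 := by
    intro h0
    rcases h with ⟨rfl, h1, -⟩ | ⟨rfl, -⟩ | ⟨rfl, h1, -⟩ | rfl
    · exact h1 (by linear_combination h0)
    · exact ha (by linear_combination h0)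
    · exact h1 (by linear_combination h3 - h0)
    · exact h2 (by linear_combination h0)
  have hsquare : ∃ e : F, e ^ ((q - 1) / 2) = 1 ∧
      ∀ d s : F, (1 - c + a) * d ^ 2 = a * s ^ 2 → d ^ 2 = e * s ^ 2 := by
    rcases h with ⟨rfl, -, h1⟩ | ⟨rfl, h1⟩ | ⟨rfl, -, m, rfl⟩ | rfl
    · exact ⟨c, h1, fun d s hds => by linear_combination hds⟩
    · exact ⟨-a, h1, fun d s hds => by linear_combination d ^ 2 * h3 - hds⟩
    · refine ⟨-1, Even.neg_one_pow ?_, fun d s hds => mul_left_cancel₀ ha ?_⟩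
      · have h9 : q % 4 = 1 := by
          rw [hq, ← two_mul, pow_mul, Nat.pow_mod]; norm_num
        exact Nat.even_iff.mpr (by omega)
      · linear_combination a * d ^ 2 * h3 - hds
    · exact ⟨1, one_pow _, fun d s hds => mul_left_cancel₀ ha (by linear_combination hds)⟩
  obtain ⟨e, he, hsq⟩ := hsquare
  refine Finite.injective_iff_bijective.mp fun x z hxz => ?_
  simp only [hform] at hxz
  have hxz' := congrArg (· ^ q) hxz
  simp only [hconj] at hxz'
  have hdq := hsub x z
  have hsq' := hadd x (x ^ q)
  rw [hqq] at hsq'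
  generalize x ^ q = y at *
  generalize z ^ q = w at *
  have hsum : x + y - (z + w) = 0 := by
    refine pow_eq_zero_iff (three_ne_zero) |>.mp (mul_left_cancel₀ hc1 ?_)
    rw [sub_pow_char, add_pow_char, add_pow_char]
    linear_combination hxz + hxz'
  obtain rfl : w = x + y - z := by linear_combination -hsum
  by_contra hne
  have hd : x - z ≠ 0 := sub_ne_zero.mpr hne
  refine hd (eq_zero_of_sq_eq_mul_sq hodd h2 (hdq.trans (by ring)) (hsq'.trans (add_comm _ _)) he
    (hsq _ _ (mul_left_cancel₀ hd ?_)))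
  grind
end

section
/- Let q be a prime power and let d be a positive integer with gcd(d, q−1) = 1, and let h be a polynomial with coefficients in the finite field F_{q²}. Suppose the map x ↦ x^d · h(x^{q−1}) is a bijection of F_{q²}. Then for all nonzero x, y ∈ F_{q²} and every λ ∈ F_{q²} with λ^q = λ, the equality x^d · h(x^{q−1}) = λ · y^d · h(y^{q−1}) implies that there exists μ ∈ F_{q²} with μ^q = μ and x = μ·y (i.e. x/y lies in the subfield F_q). -/
/-- If `d` is coprime to `n`, every `n`-th root of unity is the `d`-th power of one. -/
theorem exists_pow_eq_of_pow_eq_one_of_gcd_eq_one {F : Type*} [Field F] {d n : ℕ}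
    (hdn : Nat.gcd d n = 1) {l : F} (h0 : l ≠ 0) (hl : l ^ n = 1) :
    ∃ m : F, m ^ n = 1 ∧ m ^ d = l := by
  refine ⟨l ^ Nat.gcdA d n, ?_, ?_⟩
  · rw [← zpow_natCast, zpow_comm, zpow_natCast, hl, one_zpow]
  · have hbez := Nat.gcd_eq_gcd_ab d n
    rw [hdn, Nat.cast_one] at hbez
    have hl' : l ^ ((d : ℤ) * Nat.gcdA d n + n * Nat.gcdB d n) = l := by
      rw [← hbez, zpow_one]
    rw [zpow_add₀ h0, zpow_mul, zpow_mul, zpow_natCast, zpow_natCast, hl, one_zpow, mul_one]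
      at hl'
    rwa [← zpow_natCast, zpow_comm, zpow_natCast]

theorem stmt_2 (p e q : ℕ) (hp : p.Prime) (he : 0 < e) (hq : q = p ^ e)
    (F : Type*) [Field F] [Fintype F] (hF : Fintype.card F = q ^ 2)
    (d : ℕ) (hd : 0 < d) (hgcd : Nat.gcd d (q - 1) = 1)
    (h : Polynomial F)
    (hperm : Function.Bijective (fun x : F => x ^ d * h.eval (x ^ (q - 1)))) :
    ∀ x y : F, x ≠ 0 → y ≠ 0 → ∀ l : F, l ^ q = l →
      x ^ d * h.eval (x ^ (q - 1)) = l * (y ^ d * h.eval (y ^ (q - 1))) →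
      ∃ μ : F, μ ^ q = μ ∧ x = μ * y := by
  intro x y hx _ l hl hxy
  have hqpos : q ≠ 0 := hq ▸ (pow_pos hp.pos e).ne'
  have hl0 : l ≠ 0 := by
    rintro rfl
    refine hx (hperm.injective ?_)
    simpa [hd.ne'] using hxy
  have hl1 : l ^ (q - 1) = 1 := by
    rw [← pow_sub_one_mul hqpos] at hl
    exact (mul_eq_right₀ hl0).mp hl
  obtain ⟨m, hm1, hmd⟩ := exists_pow_eq_of_pow_eq_one_of_gcd_eq_one hgcd hl0 hl1
  refine ⟨m, ?_, hperm.injective ?_⟩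
  · rw [← pow_sub_one_mul hqpos, hm1, one_mul]
  · rw [hxy, mul_pow m y d, mul_pow m y (q - 1), hm1, hmd, one_mul, mul_assoc]
end

section
/- Let q be a prime power and let d > 1 be an odd divisor of q+1. Let i be a positive even integer and let t be a positive integer. Then gcd(d^t·(q+1), q^{i·d^{t−1}} − 1) = (q+1) · d^{t−1} · gcd(d, i). -/
/-- If `q` is congruent to `-1` modulo the odd prime `r` and `n` is even, then `r` divides
`(q ^ n - 1) / (q + 1)` exactly as often as it divides `n`. -/
lemma emultiplicity_eq_of_pow_eq_succ_mul_add_one {r q n s : ℕ} (hr : r.Prime) (hr_odd : Odd r)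
    (hrq : r ∣ q + 1) (hn : Even n) (hs : q ^ n = (q + 1) * s + 1) :
    emultiplicity r s = emultiplicity r n := by
  have hrq' : (r : ℤ) ∣ q - (-1) := by
    rw [sub_neg_eq_add]
    exact_mod_cast hrq
  have hnot : ¬ (r : ℤ) ∣ q := fun h => by
    have h1 : r ∣ 1 := (Nat.dvd_add_right (Int.natCast_dvd_natCast.mp h)).mp hrq
    exact hr.one_lt.ne' (Nat.dvd_one.mp h1)
  have h := Int.emultiplicity_pow_sub_pow hr hr_odd hrq' hnot n
  have hpow : (q : ℤ) ^ n - (-1) ^ n = ((q + 1 : ℕ) : ℤ) * (s : ℤ) := by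
    rw [hn.neg_one_pow, sub_eq_iff_eq_add]
    exact_mod_cast hs
  have hsub : (q : ℤ) - (-1) = ((q + 1 : ℕ) : ℤ) := by push_cast; ring
  rw [hpow, hsub, emultiplicity_mul (Nat.prime_iff_prime_int.mp hr), Int.natCast_emultiplicity,
    Int.natCast_emultiplicity] at h
  have hfin : FiniteMultiplicity r (q + 1) :=
    Nat.finiteMultiplicity_iff.mpr ⟨hr.ne_one, q.succ_pos⟩
  exact (ENat.add_right_injective_of_ne_top (finiteMultiplicity_iff_emultiplicity_ne_top.mp hfin)) h

/-- If every prime factor of the odd number `a` divides `q + 1` and `n` is even, then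
`(q ^ n - 1) / (q + 1)` and `n` have the same greatest common divisor with `a`. -/
lemma gcd_eq_of_pow_eq_succ_mul_add_one {a q n s : ℕ} (ha : Odd a)
    (haq : ∀ r : ℕ, r.Prime → r ∣ a → r ∣ q + 1) (hn : Even n)
    (hs : q ^ n = (q + 1) * s + 1) : Nat.gcd a s = Nat.gcd a n := by
  have key : ∀ r k : ℕ, r.Prime → r ^ k ∣ a → (r ^ k ∣ s ↔ r ^ k ∣ n) := by
    intro r k hr hk
    rcases Nat.eq_zero_or_pos k with rfl | hk0
    · simp
    · have hra : r ∣ a := (dvd_pow_self r hk0.ne').trans hk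
      rw [pow_dvd_iff_le_emultiplicity, pow_dvd_iff_le_emultiplicity,
        emultiplicity_eq_of_pow_eq_succ_mul_add_one hr (ha.of_dvd_nat hra) (haq r hr hra) hn hs]
  apply Nat.dvd_antisymm <;> rw [Nat.dvd_iff_prime_pow_dvd_dvd] <;> intro r k hr h <;>
    rw [Nat.dvd_gcd_iff] at h ⊢
  · exact ⟨h.1, (key r k hr h.1).mp h.2⟩
  · exact ⟨h.1, (key r k hr h.1).mpr h.2⟩

theorem stmt_3 (p e q : ℕ) (hp : p.Prime) (he : 0 < e) (hq : q = p ^ e)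
    (d : ℕ) (hd : 1 < d) (hodd : Odd d) (hdvd : d ∣ q + 1)
    (i t : ℕ) (hi : 0 < i) (hieven : Even i) (ht : 0 < t) :
    Nat.gcd (d ^ t * (q + 1)) (q ^ (i * d ^ (t - 1)) - 1)
      = (q + 1) * d ^ (t - 1) * Nat.gcd d i := by
  have hq0 : 0 < q := hq ▸ pow_pos hp.pos e
  have hn : Even (i * d ^ (t - 1)) := hieven.mul_right _
  have hpos : 1 ≤ q ^ (i * d ^ (t - 1)) := Nat.one_le_pow _ _ hq0
  have hdiv : q + 1 ∣ q ^ (i * d ^ (t - 1)) - 1 := by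
    have h := sub_dvd_pow_sub_pow (q : ℤ) (-1) (i * d ^ (t - 1))
    rw [hn.neg_one_pow, sub_neg_eq_add] at h
    zify [hpos]
    exact h
  obtain ⟨s, hs⟩ := hdiv
  have hs' : q ^ (i * d ^ (t - 1)) = (q + 1) * s + 1 := by omega
  have hgcd := gcd_eq_of_pow_eq_succ_mul_add_one (a := d ^ t) hodd.pow
    (fun r hr h => (hr.dvd_of_dvd_pow h).trans hdvd) hn hs'
  have hdt : d ^ t = d * d ^ (t - 1) := by rw [← pow_succ', Nat.sub_add_cancel ht]
  rw [hs, mul_comm (d ^ t), Nat.gcd_mul_left, hgcd, hdt, Nat.gcd_mul_right]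
  ring
end

section
/- Let q be a prime power, let d > 1 be an odd divisor of q+1, let t be a positive integer, and set N = d^t·(q+1). Then q is coprime to N and the multiplicative order of q modulo N (i.e. the order of the residue of q in the unit group of the ring Z/NZ) equals 2·d^t. -/
theorem Int.emultiplicity_geom_sum {p : ℕ} (hp : p.Prime) (hodd : Odd p) {a : ℤ} (ha : a ≠ 1)
    (hpa : (p : ℤ) ∣ a - 1) (m : ℕ) :
    emultiplicity (p : ℤ) (∑ i ∈ Finset.range m, a ^ i) = emultiplicity p m := by
  have hpa' : ¬ (p : ℤ) ∣ a := fun h =>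
    (Nat.prime_iff_prime_int.mp hp).not_dvd_one (by simpa using dvd_sub h hpa)
  have hfin : FiniteMultiplicity (p : ℤ) (a - 1) := by
    rw [Int.finiteMultiplicity_iff]
    exact ⟨by simpa using hp.ne_one, sub_ne_zero.mpr ha⟩
  have h := Int.emultiplicity_pow_sub_pow hp hodd hpa hpa' m
  rw [one_pow, ← mul_geom_sum, emultiplicity_mul (Nat.prime_iff_prime_int.mp hp)] at h
  exact ENat.add_right_injective_of_ne_top
    (finiteMultiplicity_iff_emultiplicity_ne_top.mp hfin) h

theorem Int.natCast_mul_sub_one_dvd_pow_sub_one_iff {D : ℕ} (hodd : Odd D) {a : ℤ} (ha : a ≠ 1)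
    (hD : ∀ p : ℕ, p.Prime → p ∣ D → (p : ℤ) ∣ a - 1) (m : ℕ) :
    (D : ℤ) * (a - 1) ∣ a ^ m - 1 ↔ D ∣ m := by
  rw [← geom_sum_mul, mul_dvd_mul_iff_right (sub_ne_zero.mpr ha), Int.natCast_dvd,
    Nat.dvd_iff_prime_pow_dvd_dvd, Nat.dvd_iff_prime_pow_dvd_dvd]
  refine forall₄_congr fun p k hp hk => ?_
  rcases k.eq_zero_or_pos with rfl | hk0
  · simp
  have hpD : p ∣ D := (dvd_pow_self p hk0.ne').trans hk
  rw [← Int.natCast_dvd, Nat.cast_pow, pow_dvd_iff_le_emultiplicity,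
    Int.emultiplicity_geom_sum hp (hodd.of_dvd_nat hpD) ha (hD p hp hpD),
    pow_dvd_iff_le_emultiplicity]

theorem stmt_4 (p e q : ℕ) (hp : p.Prime) (he : 0 < e) (hq : q = p ^ e)
    (d : ℕ) (hd : 1 < d) (hodd : Odd d) (hdvd : d ∣ q + 1)
    (t : ℕ) (ht : 0 < t) (N : ℕ) (hN : N = d ^ t * (q + 1)) :
    Nat.Coprime q N ∧ orderOf (q : ZMod N) = 2 * d ^ t := by
  have hq1 : 1 < q := hq ▸ Nat.one_lt_pow he.ne' hp.one_lt
  have hcop : Nat.Coprime q (q + 1) := by simp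
  refine ⟨hN ▸ ((hcop.coprime_dvd_right hdvd).pow_right t).mul_right hcop, ?_⟩
  have hpow (n : ℕ) : (q : ZMod N) ^ n = 1 ↔ (N : ℤ) ∣ (q : ℤ) ^ n - 1 := by
    rw [← ZMod.intCast_zmod_eq_zero_iff_dvd]
    push_cast
    exact sub_eq_zero.symm
  have hneg (m : ℕ) : (N : ℤ) ∣ (-q : ℤ) ^ m - 1 ↔ d ^ t ∣ m := by
    rw [← Int.natCast_mul_sub_one_dvd_pow_sub_one_iff (a := -q) hodd.pow (by lia)
      (fun r hr hrd => ?_) m]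
    · rw [hN, ← neg_dvd]
      push_cast
      ring_nf
    · have h := (hr.dvd_of_dvd_pow hrd).trans hdvd
      rw [← Int.natCast_dvd_natCast, ← dvd_neg] at h
      rwa [show (-q : ℤ) - 1 = -((q + 1 : ℕ) : ℤ) by push_cast; ring]
  apply Nat.dvd_antisymm
  · rw [orderOf_dvd_iff_pow_eq_one, hpow, ← (even_two_mul (d ^ t)).neg_pow, hneg]
    exact dvd_mul_left _ _
  · have h := (hpow _).mp (pow_orderOf_eq_one (q : ZMod N))
    have heven : Even (orderOf (q : ZMod N)) := by
      by_contra ho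
      rw [Nat.not_even_iff_odd] at ho
      have h1 : (q + 1 : ℤ) ∣ (q : ℤ) ^ orderOf (q : ZMod N) + 1 := by
        simpa using ho.add_dvd_pow_add_pow (q : ℤ) 1
      have h2 : (q + 1 : ℤ) ∣ (q : ℤ) ^ orderOf (q : ZMod N) - 1 :=
        Dvd.dvd.trans ⟨(d : ℤ) ^ t, by rw [hN]; push_cast; ring⟩ h
      have h3 : (q + 1 : ℤ) ∣ 2 := by
        have := dvd_sub h1 h2
        ring_nf at this ⊢
        exact this
      have := Int.le_of_dvd two_pos h3
      lia
    rw [← heven.neg_pow, hneg] at h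
    exact Nat.Coprime.mul_dvd_of_dvd_of_dvd (Nat.coprime_two_left.mpr hodd.pow)
      heven.two_dvd h
end

section
/- Let q be a prime power, let d > 1 be an odd divisor of q+1, let u be a proper divisor of d (u divides d and u < d), let t be a positive integer, and set n = d^t·u. Let δ be an element of the finite field F_{q²} whose multiplicative order is q+1. Then δ^n ≠ δ, and the polynomial g_n(X) = ((δ·X − 1)^n − δ·(X − δ)^n)/(δ^n − δ) over F_{q²} has degree n and every coefficient c of g_n satisfies c^q = c (i.e. all coefficients of g_n lie in the subfield F_q). -/
open Polynomial in
/-- A linear combination of `n`-th powers of linear polynomials has degree `n` as soon as the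
expected leading coefficient is nonzero. -/
lemma natDegree_linear_pow_sub {F : Type*} [Field F] (δ : F) (n : ℕ) (h : δ ^ n ≠ δ) :
    ((C δ * X - 1) ^ n - C δ * (X - C δ) ^ n : F[X]).natDegree = n := by
  have h₁ : (C δ * X - 1 : F[X]).natDegree ≤ 1 := by compute_degree
  have h₂ : (X - C δ : F[X]).natDegree ≤ 1 := by compute_degree
  have c₁ := coeff_pow_of_natDegree_le (m := n) h₁
  have c₂ := coeff_pow_of_natDegree_le (m := n) h₂
  have d₁ := natDegree_pow_le_of_le n h₁
  have d₂ := natDegree_pow_le_of_le n h₂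
  simp only [mul_one] at c₁ c₂ d₁ d₂
  refine natDegree_eq_of_le_of_coeff_ne_zero
    (natDegree_sub_le_of_le d₁ ((natDegree_C_mul_le _ _).trans d₂) |>.trans (by simp)) ?_
  rw [coeff_sub, coeff_C_mul, c₁, c₂]
  simpa [coeff_one, coeff_C, sub_eq_zero] using h

open Polynomial in
/-- A ring homomorphism inverting `δ` fixes the normalized polynomial
`((δX - 1)^n - δ(X - δ)^n) / (δ^n - δ)`. -/
lemma map_normalized_linear_pow_sub {F : Type*} [Field F] (φ : F →+* F) (δ : F) (hδ : δ ≠ 0)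
    (hφ : φ δ = δ⁻¹) (n : ℕ) (h : δ ^ n ≠ δ) :
    (C (δ ^ n - δ)⁻¹ * ((C δ * X - 1) ^ n - C δ * (X - C δ) ^ n)).map φ =
      C (δ ^ n - δ)⁻¹ * ((C δ * X - 1) ^ n - C δ * (X - C δ) ^ n) := by
  have hC : C δ * C δ⁻¹ = 1 := by rw [← C_mul, mul_inv_cancel₀ hδ, C_1]
  have e₁ : C δ⁻¹ * X - 1 = C δ⁻¹ * (X - C δ) := by linear_combination hC
  have e₂ : X - C δ⁻¹ = C δ⁻¹ * (C δ * X - 1) := by linear_combination -X * hC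
  have hinv : (δ⁻¹ ^ n - δ⁻¹)⁻¹ = -(δ ^ (n + 1)) * (δ ^ n - δ)⁻¹ := by
    rw [show δ⁻¹ ^ n - δ⁻¹ = -(δ ^ n - δ) * (δ ^ (n + 1))⁻¹ by rw [inv_pow]; field_simp; ring]
    rw [mul_inv, inv_inv, inv_neg]
    ring
  have hp : C δ ^ n * C δ⁻¹ ^ n = 1 := by rw [← mul_pow, hC, one_pow]
  simp only [Polynomial.map_mul, Polynomial.map_sub, Polynomial.map_pow, map_C, map_X,
    Polynomial.map_one, map_inv₀, map_sub, map_pow, hφ, hinv]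
  simp only [← map_pow, e₁, e₂, mul_pow, C_mul, C_neg]
  simp only [C_pow]
  linear_combination C (δ ^ n - δ)⁻¹ *
    ((C δ * C δ⁻¹ * (C δ * X - 1) ^ n - C δ * (X - C δ) ^ n) * hp + (C δ * X - 1) ^ n * hC)

open Polynomial in
theorem stmt_5 (p e q : ℕ) (hp : p.Prime) (he : 0 < e) (hq : q = p ^ e)
    (F : Type*) [Field F] [Fintype F] (hF : Fintype.card F = q ^ 2)
    (d : ℕ) (hd : 1 < d) (hodd : Odd d) (hdvd : d ∣ q + 1)
    (u : ℕ) (hu : u ∣ d) (hud : u < d)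
    (t : ℕ) (ht : 0 < t) (n : ℕ) (hn : n = d ^ t * u)
    (δ : F) (hδ : orderOf δ = q + 1)
    (g : Polynomial F)
    (hg : g = C (δ ^ n - δ)⁻¹ * ((C δ * X - 1) ^ n - C δ * (X - C δ) ^ n)) :
    δ ^ n ≠ δ ∧ g.natDegree = n ∧ ∀ i : ℕ, (g.coeff i) ^ q = g.coeff i := by
  have hpow : δ ^ q * δ = 1 := by rw [← pow_succ, ← hδ, pow_orderOf_eq_one]
  have hδ0 : δ ≠ 0 := right_ne_zero_of_mul_eq_one hpow
  have hdn : d ∣ n := hn ▸ (dvd_pow_self d ht.ne').mul_right u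
  have hne : δ ^ n ≠ δ := fun h => by
    have h1 : δ ^ (n + q) = 1 := by rw [pow_add, h, mul_comm, hpow]
    have h2 : d ∣ n + q := hdvd.trans (hδ ▸ orderOf_dvd_of_pow_eq_one h1)
    have h3 : d ∣ 1 := (Nat.dvd_add_right ((Nat.dvd_add_right hdn).1 h2)).1 hdvd
    exact hd.ne' (Nat.dvd_one.1 h3)
  have : Fact p.Prime := ⟨hp⟩
  have : CharP F p := charP_of_card_eq_prime_pow (f := e * 2) (by
    rw [hF, hq, pow_mul])
  refine ⟨hne, ?_, fun i => ?_⟩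
  · rw [hg, natDegree_C_mul (inv_ne_zero (sub_ne_zero.2 hne)), natDegree_linear_pow_sub δ n hne]
  · have hφ : iterateFrobenius F p e δ = δ⁻¹ := by
      rw [iterateFrobenius_def, ← hq, eq_inv_of_mul_eq_one_left hpow]
    have hmap := congrArg (coeff · i) (map_normalized_linear_pow_sub _ δ hδ0 hφ n hne)
    simpa only [← hg, coeff_map, iterateFrobenius_def, ← hq] using hmap
end

section
/- Let q be a prime power, let d > 1 be an odd divisor of q+1, let u be a proper divisor of d (u divides d and u < d), let t be a positive integer, and set n = d^t·u. Let δ be an element of the finite field F_{q²} whose multiplicative order is q+1. Then the polynomial g_n(X) = ((δ·X − 1)^n − δ·(X − δ)^n)/(δ^n − δ) is irreducible in F_{q²}[X]. -/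
open Polynomial in
/-- A projective change of variable preserves irreducibility of `X ^ n - C k`, as long as the
degree does not drop. -/
theorem irreducible_pow_sub_C_mul_pow {F : Type*} [Field F] {n : ℕ} (hn : n ≠ 0) {k a b c e : F}
    (hirr : Irreducible (X ^ n - C k : F[X])) (hdet : a * e - b * c ≠ 0)
    (hlead : a ^ n - k * c ^ n ≠ 0) :
    Irreducible ((C a * X + C b) ^ n - C k * (C c * X + C e) ^ n) := by
  set g : F[X] := (C a * X + C b) ^ n - C k * (C c * X + C e) ^ n with hg
  have hcoeff : g.coeff n = a ^ n - k * c ^ n := by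
    have h (x y : F) : ((C x * X + C y) ^ n).coeff n = x ^ n := by
      simpa using coeff_pow_of_natDegree_le (m := n) (natDegree_linear_le (a := x) (b := y))
    rw [hg, coeff_sub, coeff_C_mul, h, h]
  have hle : g.natDegree ≤ n := by
    have h (x y : F) : ((C x * X + C y) ^ n).natDegree ≤ n := by
      simpa using natDegree_pow_le_of_le n (natDegree_linear_le (a := x) (b := y))
    exact natDegree_sub_le_of_le (h a b) ((natDegree_C_mul_le _ _).trans (h c e)) |>.trans (by simp)
  have hge : n ≤ g.natDegree := le_natDegree_of_ne_zero (hcoeff ▸ hlead)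
  have hg0 : g ≠ 0 := by
    intro h
    rw [h, coeff_zero] at hcoeff
    exact hlead hcoeff.symm
  have hunit : ¬ IsUnit g := fun h ↦ hn <| by
    have := natDegree_eq_zero_of_isUnit h
    omega
  obtain ⟨f, hf, hfg⟩ := WfDvdMonoid.exists_irreducible_factor hunit hg0
  have : Fact (Irreducible f) := ⟨hf⟩
  set i := AdjoinRoot.of f
  set α := AdjoinRoot.root f
  have hroot : (i a * α + i b) ^ n = i k * (i c * α + i e) ^ n := by
    have h : g.eval₂ i α = 0 :=
      eval₂_eq_zero_of_dvd_of_eval₂_eq_zero i α hfg (AdjoinRoot.eval₂_root f)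
    simpa [hg, eval₂_sub, eval₂_mul, eval₂_pow, eval₂_add, sub_eq_zero] using h
  have hden : i c * α + i e ≠ 0 := by
    intro h
    rw [h, zero_pow hn, mul_zero] at hroot
    have hnum := eq_zero_of_pow_eq_zero hroot
    have hc : i (a * e - b * c) = 0 := by
      simp only [map_sub, map_mul]
      linear_combination i a * h - i c * hnum
    exact hdet ((map_eq_zero i).1 hc)
  have hmin : X ^ n - C k = minpoly F ((i a * α + i b) / (i c * α + i e)) := by
    refine minpoly.eq_of_irreducible_of_monic hirr ?_ (monic_X_pow_sub_C k hn)
    have : algebraMap F (AdjoinRoot f) k = i k := rfl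
    rw [map_sub, map_pow, aeval_X, aeval_C, this, div_pow, hroot,
      mul_div_cancel_right₀ _ (pow_ne_zero n hden), sub_self]
  have hnf : n ≤ f.natDegree := by
    have : FiniteDimensional F (AdjoinRoot f) := (AdjoinRoot.powerBasis hf.ne_zero).finite
    have h := minpoly.natDegree_le (A := F) ((i a * α + i b) / (i c * α + i e))
    rwa [← hmin, natDegree_X_pow_sub_C, (AdjoinRoot.powerBasis hf.ne_zero).finrank,
      AdjoinRoot.powerBasis_dim] at h
  exact (associated_of_dvd_of_natDegree_le hfg hg0 (hle.trans hnf)).irreducible hf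

open Polynomial in
/-- If every prime factor of the odd number `n` divides `q + 1`, then `X ^ n - C δ` is irreducible
over the field with `q ^ 2` elements for every `δ` of order `q + 1`. -/
theorem irreducible_X_pow_sub_C_of_orderOf_eq {F : Type*} [Field F] [Fintype F] {q : ℕ}
    (hq : 1 < q) (hF : Fintype.card F = q ^ 2) {n : ℕ} (hn : Odd n)
    (hdvd : ∀ r : ℕ, r.Prime → r ∣ n → r ∣ q + 1) {δ : F} (hδ : orderOf δ = q + 1) :
    Irreducible (X ^ n - C δ : F[X]) := by
  refine X_pow_sub_C_irreducible_of_odd hn fun r hr hrn b hb ↦ ?_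
  obtain ⟨m, hm⟩ := hdvd r hr hrn
  have hδ0 : δ ≠ 0 := by
    rintro rfl
    simp at hδ
  have hb0 : b ≠ 0 := by
    rintro rfl
    exact hδ0 (by rw [← hb, zero_pow hr.ne_zero])
  have hcard : q ^ 2 - 1 = (q + 1) * (q - 1) := by
    simpa using Nat.sq_sub_sq q 1
  have hpow : δ ^ (m * (q - 1)) = 1 := by
    rw [← hb, ← pow_mul, ← mul_assoc, ← hm, ← hcard, ← hF]
    exact FiniteField.pow_card_sub_one_eq_one b hb0
  have h := orderOf_dvd_of_pow_eq_one hpow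
  have hm0 : 0 < m := Nat.pos_of_ne_zero (by rintro rfl; simp at hm)
  rw [hδ, hm, mul_comm r m] at h
  have hsub : r ∣ q - 1 := Nat.dvd_of_mul_dvd_mul_left hm0 h
  have htwo : r ∣ 2 := by
    have := Nat.dvd_sub (Dvd.intro m hm.symm) hsub
    rwa [show q + 1 - (q - 1) = 2 by omega] at this
  have hr2 := (Nat.prime_dvd_prime_iff_eq hr Nat.prime_two).1 htwo
  exact Nat.not_even_iff_odd.2 hn (even_iff_two_dvd.2 (hr2 ▸ hrn))

open Polynomial in
theorem stmt_6 (p e q : ℕ) (hp : p.Prime) (he : 0 < e) (hq : q = p ^ e)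
    (F : Type*) [Field F] [Fintype F] (hF : Fintype.card F = q ^ 2)
    (d : ℕ) (hd : 1 < d) (hodd : Odd d) (hdvd : d ∣ q + 1)
    (u : ℕ) (hu : u ∣ d) (hud : u < d)
    (t : ℕ) (ht : 0 < t) (n : ℕ) (hn : n = d ^ t * u)
    (δ : F) (hδ : orderOf δ = q + 1)
    (g : Polynomial F)
    (hg : g = C (δ ^ n - δ)⁻¹ * ((C δ * X - 1) ^ n - C δ * (X - C δ) ^ n)) :
    Irreducible g := by
  have hq1 : 1 < q := hq ▸ Nat.one_lt_pow he.ne' hp.one_lt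
  have hnodd : Odd n := hn ▸ hodd.pow.mul (hodd.of_dvd_nat hu)
  have hdn : d ∣ n := hn ▸ (dvd_pow_self d ht.ne').mul_right u
  have hprime (r : ℕ) (hr : r.Prime) (hrn : r ∣ n) : r ∣ q + 1 := by
    rw [hn] at hrn
    rcases hr.dvd_mul.1 hrn with h | h
    · exact (hr.dvd_of_dvd_pow h).trans hdvd
    · exact h.trans (hu.trans hdvd)
  have hδ0 : δ ≠ 0 := by
    rintro rfl
    simp at hδ
  have hlead : δ ^ n - δ ≠ 0 := by
    intro h
    have hpow : δ ^ (n - 1) = 1 := by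
      refine mul_right_cancel₀ hδ0 ?_
      rw [pow_sub_one_mul hnodd.pos.ne', one_mul]
      exact sub_eq_zero.1 h
    have h1 : d ∣ n - 1 := hdvd.trans (hδ ▸ orderOf_dvd_of_pow_eq_one hpow)
    have h2 := Nat.dvd_sub hdn h1
    rw [Nat.sub_sub_self hnodd.pos, Nat.dvd_one] at h2
    omega
  have hdet : δ * -δ - -1 * 1 ≠ 0 := by
    intro h
    have hsq : δ ^ 2 = 1 := by linear_combination -h
    have := Nat.le_of_dvd two_pos (orderOf_dvd_of_pow_eq_one hsq)
    omega
  have key := irreducible_pow_sub_C_mul_pow hnodd.pos.ne'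
    (irreducible_X_pow_sub_C_of_orderOf_eq hq1 hF hnodd hprime hδ) hdet (by simpa using hlead)
  rw [hg, irreducible_isUnit_mul (isUnit_C.2 (inv_ne_zero hlead).isUnit)]
  simpa [← sub_eq_add_neg] using key
end

section
/- Let q be a prime power, let d > 1 be an odd divisor of q+1, let u be a proper divisor of d (u divides d and u < d), let t be a positive integer, and set n = d^t·u. Then for every integer i with 1 ≤ i ≤ (n−1)/2 one has gcd(n·(q+1), q^{2i} − 1) < n·(q+1). -/
/-- If every prime factor of `n` is an odd divisor of `q + 1`, then `n * (q + 1)` can divide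
`q ^ (2 * i) - 1` only when `n` divides `i`. -/
theorem dvd_of_mul_succ_dvd_pow_sub_one {q n i : ℕ} (hq : 1 < q) (hn : n ≠ 0) (hi : i ≠ 0)
    (hodd : Odd n) (hprime : ∀ r : ℕ, r.Prime → r ∣ n → r ∣ q + 1)
    (h : n * (q + 1) ∣ q ^ (2 * i) - 1) : n ∣ i := by
  rw [← Nat.factorization_prime_le_iff_dvd hn hi]
  intro r hr
  by_cases hrn : r ∣ n
  swap
  · simp [Nat.factorization_eq_zero_of_not_dvd hrn]
  have : Fact r.Prime := ⟨hr⟩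
  have hrodd : Odd r := Odd.of_dvd_nat hodd hrn
  have hrq1 : r ∣ q + 1 := hprime r hr hrn
  have hrq : ¬ r ∣ q := fun hrq => hr.one_lt.ne' (Nat.dvd_one.mp ((Nat.dvd_add_right hrq).mp hrq1))
  have hrq_sub : ¬ r ∣ q - 1 := by
    intro hrs
    have h2 : r ∣ 2 := by
      have := Nat.dvd_sub hrq1 hrs
      rwa [show q + 1 - (q - 1) = 2 by omega] at this
    have := (Nat.prime_dvd_prime_iff_eq hr Nat.prime_two).mp h2
    subst this
    exact absurd hrodd (by decide)
  have hsq : q ^ 2 - 1 ^ 2 = (q + 1) * (q - 1) := Nat.sq_sub_sq q 1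
  have hlte : padicValNat r ((q ^ 2) ^ i - (1 ^ 2) ^ i) =
      padicValNat r (q ^ 2 - 1 ^ 2) + padicValNat r i :=
    padicValNat.pow_sub_pow hrodd (Nat.pow_lt_pow_left hq two_ne_zero) (hsq ▸ hrq1.mul_right _)
      (fun hrsq => hrq (hr.dvd_of_dvd_pow hrsq)) hi
  rw [hsq, padicValNat.mul (by omega) (by omega), padicValNat.eq_zero_of_not_dvd hrq_sub,
    ← pow_mul, one_pow, one_pow] at hlte
  have hpos : q ^ (2 * i) - 1 ≠ 0 := by
    have := Nat.one_lt_pow (show 2 * i ≠ 0 by omega) hq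
    omega
  have hle := (Nat.factorization_le_iff_dvd (by positivity) hpos).mpr h r
  rw [Nat.factorization_def _ hr, Nat.factorization_def _ hr, hlte,
    padicValNat.mul hn (by omega)] at hle
  rw [Nat.factorization_def _ hr, Nat.factorization_def _ hr]
  omega

theorem stmt_7 (p e q : ℕ) (hp : p.Prime) (he : 0 < e) (hq : q = p ^ e)
    (d : ℕ) (hd : 1 < d) (hodd : Odd d) (hdvd : d ∣ q + 1)
    (u : ℕ) (hu : u ∣ d) (hud : u < d)
    (t : ℕ) (ht : 0 < t) (n : ℕ) (hn : n = d ^ t * u) :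
    ∀ i : ℕ, 1 ≤ i → i ≤ (n - 1) / 2 →
      Nat.gcd (n * (q + 1)) (q ^ (2 * i) - 1) < n * (q + 1) := by
  intro i hi hin
  have hn0 : 0 < n := by omega
  have hq1 : 1 < q := hq ▸ Nat.one_lt_pow he.ne' hp.one_lt
  refine lt_of_le_of_ne (Nat.gcd_le_left _ (by positivity)) fun hgcd => ?_
  have hni : n ∣ i := by
    refine dvd_of_mul_succ_dvd_pow_sub_one hq1 hn0.ne' (by omega) ?_ ?_
      (Nat.gcd_eq_left_iff_dvd.mp hgcd)
    · exact hn ▸ hodd.pow.mul (Odd.of_dvd_nat hodd hu)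
    · intro r hr hrn
      rw [hn, hr.dvd_mul] at hrn
      exact (hrn.elim hr.dvd_of_dvd_pow fun h => h.trans hu).trans hdvd
  have := Nat.le_of_dvd hi hni
  omega
end

section
/- Let q be a prime power, let d > 1 be an odd divisor of q+1, let u be a proper divisor of d (u divides d and u < d), let t be a positive integer, and set n = d^t·u. Let δ be an element of the finite field F_{q²} whose multiplicative order is q+1, and let g_n(X) = ((δ·X − 1)^n − δ·(X − δ)^n)/(δ^n − δ) over F_{q²}. Then the map c ↦ c^n · g_n(c^{q−1}) is a bijection of F_{q²}. -/
/-- Elements of a common eigenline `a * x ^ q = b * x` of the `q`-power map, `a ≠ 0`, are determined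
by their `n`-th power when `n` is coprime to `q - 1`. -/
theorem eq_of_pow_eq_pow_of_mul_pow_eq_mul {F : Type*} [Field F] {q n : ℕ} (hq : 0 < q)
    (hn : n ≠ 0) (hcop : n.Coprime (q - 1)) {a b x y : F} (ha : a ≠ 0)
    (hx : a * x ^ q = b * x) (hy : a * y ^ q = b * y) (h : x ^ n = y ^ n) : x = y := by
  by_cases hy0 : y = 0
  · subst hy0
    rw [zero_pow hn] at h
    exact eq_zero_of_pow_eq_zero h
  have hx0 : x ≠ 0 := by
    rintro rfl
    rw [zero_pow hn] at h
    exact hy0 (eq_zero_of_pow_eq_zero h.symm)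
  have key : x ^ q * y = y ^ q * x := by
    apply mul_left_cancel₀ ha
    linear_combination y * hx - x * hy
  obtain ⟨k, rfl⟩ : ∃ k, q = k + 1 := ⟨q - 1, by omega⟩
  have hk : x ^ k = y ^ k := by
    apply mul_right_cancel₀ (mul_ne_zero hx0 hy0)
    linear_combination key
  have h1 : (x / y) ^ n = 1 := by rw [div_pow, h, div_self (pow_ne_zero _ hy0)]
  have h2 : (x / y) ^ k = 1 := by rw [div_pow, hk, div_self (pow_ne_zero _ hy0)]
  have h3 : orderOf (x / y) ∣ 1 := by
    have := Nat.dvd_gcd (orderOf_dvd_of_pow_eq_one h1) (orderOf_dvd_of_pow_eq_one h2)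
    rwa [show n.gcd k = 1 from hcop] at this
  have h4 : x / y = 1 := orderOf_eq_one_iff.mp (Nat.dvd_one.mp h3)
  exact (div_eq_one_iff_eq hy0).mp h4

/-- An odd divisor of `q + 1` is coprime to `q - 1`. -/
theorem Nat.Coprime.of_odd_of_dvd_add_one {d q : ℕ} (hq : 0 < q) (hodd : Odd d)
    (hdvd : d ∣ q + 1) : d.Coprime (q - 1) := by
  have h2 : d.gcd (q - 1) ∣ 2 := by
    have h := Nat.dvd_sub ((Nat.gcd_dvd_left d (q - 1)).trans hdvd) (Nat.gcd_dvd_right d (q - 1))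
    rwa [show q + 1 - (q - 1) = 2 by omega] at h
  rcases (Nat.dvd_prime Nat.prime_two).mp h2 with h | h
  · exact h
  · exact absurd (h ▸ Nat.gcd_dvd_left d (q - 1)) hodd.not_two_dvd_nat

open Polynomial in
theorem stmt_8 (p e q : ℕ) (hp : p.Prime) (he : 0 < e) (hq : q = p ^ e)
    (F : Type*) [Field F] [Fintype F] (hF : Fintype.card F = q ^ 2)
    (d : ℕ) (hd : 1 < d) (hodd : Odd d) (hdvd : d ∣ q + 1)
    (u : ℕ) (hu : u ∣ d) (hud : u < d)
    (t : ℕ) (ht : 0 < t) (n : ℕ) (hn : n = d ^ t * u)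
    (δ : F) (hδ : orderOf δ = q + 1)
    (g : Polynomial F)
    (hg : g = C (δ ^ n - δ)⁻¹ * ((C δ * X - 1) ^ n - C δ * (X - C δ) ^ n)) :
    Function.Bijective (fun c : F => c ^ n * g.eval (c ^ (q - 1))) := by
  have : Fact p.Prime := ⟨hp⟩
  have hq1 : 1 < q := hq ▸ Nat.one_lt_pow he.ne' hp.one_lt
  have hchar : CharP F p := by
    have hc : Fintype.card F = p ^ (e * 2) := by rw [hF, hq, pow_mul]
    exact charP_of_card_eq_prime_pow hc
  have hsub (x y : F) : (x - y) ^ q = x ^ q - y ^ q := hq ▸ sub_pow_char_pow x y e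
  have hqq (x : F) : (x ^ q) ^ q = x := by
    rw [← pow_mul, ← sq, ← hF, FiniteField.pow_card]
  have hnodd : Odd n := hn ▸ (hodd.pow.mul (hodd.of_dvd_nat hu))
  have hn0 : n ≠ 0 := hnodd.pos.ne'
  have hcop : n.Coprime (q - 1) := by
    have h := Nat.Coprime.of_odd_of_dvd_add_one (by omega) hodd hdvd
    exact hn ▸ (h.pow_left t).mul_left (h.coprime_dvd_left hu)
  have hδ1 : δ ^ q * δ = 1 := by rw [← pow_succ, ← hδ, pow_orderOf_eq_one]
  have hδ0 : δ ≠ 0 := right_ne_zero_of_mul_eq_one hδ1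
  have hδ2 : δ ^ 2 - 1 ≠ 0 := by
    intro h
    have := Nat.le_of_dvd two_pos (orderOf_dvd_of_pow_eq_one (sub_eq_zero.mp h))
    omega
  have hδq : δ - δ ^ q ≠ 0 := by
    intro h
    exact hδ2 (by linear_combination δ * h + hδ1)
  have hK : (δ ^ n - δ)⁻¹ ≠ 0 := by
    refine inv_ne_zero (sub_ne_zero.mpr fun h => ?_)
    obtain ⟨m, hm⟩ : ∃ m, n = m + 1 := ⟨n - 1, by omega⟩
    have hm1 : δ ^ m = 1 := by
      apply mul_right_cancel₀ hδ0
      rw [← pow_succ, ← hm, h, one_mul]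
    have hdm : d ∣ m := hdvd.trans (hδ ▸ orderOf_dvd_of_pow_eq_one hm1)
    have hdn : d ∣ n := hn ▸ (dvd_pow_self d ht.ne').mul_right u
    have := Nat.le_of_dvd one_pos ((Nat.dvd_add_right hdm).mp (hm ▸ hdn))
    omega
  have hf (c : F) : c ^ n * g.eval (c ^ (q - 1)) =
      (δ ^ n - δ)⁻¹ * ((δ * c ^ q - c) ^ n - δ * (c ^ q - δ * c) ^ n) := by
    have hc : c ^ q = c * c ^ (q - 1) := by rw [← pow_succ', Nat.sub_add_cancel hq1.le]
    rw [hg, hc, show δ * (c * c ^ (q - 1)) - c = c * (δ * c ^ (q - 1) - 1) by ring,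
      show c * c ^ (q - 1) - δ * c = c * (c ^ (q - 1) - δ) by ring, mul_pow, mul_pow]
    simp only [eval_mul, eval_sub, eval_pow, eval_C, eval_X, eval_one]
    ring
  have hA (c : F) : δ * (δ * c ^ q - c) ^ q = -1 * (δ * c ^ q - c) := by
    rw [hsub, mul_pow, hqq]
    linear_combination c * hδ1
  have hB (c : F) : δ * (c ^ q - δ * c) ^ q = -1 * (c ^ q - δ * c) := by
    rw [hsub, mul_pow, hqq]
    linear_combination -c ^ q * hδ1
  have hconj (a b : F) (ha : δ * a ^ q = -1 * a) (hb : δ * b ^ q = -1 * b) :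
      δ ^ n * (a ^ n - δ * b ^ n) ^ q = -a ^ n + δ ^ q * b ^ n := by
    have ha' : δ ^ n * (a ^ n) ^ q = -a ^ n := by
      rw [pow_right_comm, ← mul_pow, ha, neg_one_mul, hnodd.neg_pow]
    have hb' : δ ^ n * (b ^ n) ^ q = -b ^ n := by
      rw [pow_right_comm, ← mul_pow, hb, neg_one_mul, hnodd.neg_pow]
    rw [hsub, mul_pow]
    linear_combination ha' - δ ^ q * hb'
  refine Finite.injective_iff_bijective.mp fun x y hxy => ?_
  simp only [hf] at hxy
  have h1 := mul_left_cancel₀ hK hxy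
  have h2 := hconj _ _ (hA x) (hB x)
  rw [h1, hconj _ _ (hA y) (hB y)] at h2
  have hBn : (x ^ q - δ * x) ^ n = (y ^ q - δ * y) ^ n := by
    apply mul_left_cancel₀ hδq
    linear_combination -h1 + h2
  have hAn : (δ * x ^ q - x) ^ n = (δ * y ^ q - y) ^ n := by
    linear_combination h1 + δ * hBn
  have hAeq := eq_of_pow_eq_pow_of_mul_pow_eq_mul (by omega) hn0 hcop hδ0 (hA x) (hA y) hAn
  have hBeq := eq_of_pow_eq_pow_of_mul_pow_eq_mul (by omega) hn0 hcop hδ0 (hB x) (hB y) hBn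
  apply mul_left_cancel₀ hδ2
  linear_combination hAeq - δ * hBeq
end

section
/- Let p be an odd prime and let h(X) = X^p + X^{p−1} + ⋯ + X − 1 (that is, h(X) = (X^{p+1} − 1)/(X − 1) − 2) be regarded as a polynomial over the finite field F_{p²}. Then for every c ∈ F_{p²}: if c is a nonzero element of the subfield F_p (i.e. c ≠ 0 and c^p = c) then c^p · h(c^{p−1}) = −c, and otherwise c^p · h(c^{p−1}) = −2·c^p. In particular, the map c ↦ c^p · h(c^{p−1}) is a bijection of F_{p²}. -/
open Polynomial in
theorem stmt_10 (p : ℕ) (hp : p.Prime) (hodd : Odd p)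
    (F : Type*) [Field F] [Fintype F] (hF : Fintype.card F = p ^ 2)
    (h : Polynomial F)
    (hh : h = (∑ i ∈ Finset.range p, X ^ (i + 1)) - 1) :
    (∀ c : F, (c ≠ 0 ∧ c ^ p = c → c ^ p * h.eval (c ^ (p - 1)) = -c) ∧
      (¬(c ≠ 0 ∧ c ^ p = c) → c ^ p * h.eval (c ^ (p - 1)) = -2 * c ^ p)) ∧
    Function.Bijective (fun c : F => c ^ p * h.eval (c ^ (p - 1))) := by
  have : Fact p.Prime := ⟨hp⟩
  have : CharP F p := charP_of_card_eq_prime_pow hF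
  have two_ne : (2 : F) ≠ 0 :=
    Ring.two_ne_zero (by rw [ringChar.eq F p]; rintro rfl; exact absurd hodd (by decide))
  have frob_inj : ∀ c d : F, c ^ p = d ^ p → c = d := fun c d hcd => frobenius_inj F p hcd
  have frob_sq : ∀ c : F, (c ^ p) ^ p = c := fun c => by
    rw [← pow_mul, ← sq, ← hF, FiniteField.pow_card]
  have two_pow : (2 : F) ^ p = 2 := map_ofNat (frobenius F p) 2
  have pow_split : ∀ c : F, c ^ p = c * c ^ (p - 1) := fun c => by
    rw [← pow_succ', Nat.sub_add_cancel hp.one_le]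
  have eval_h : ∀ t : F, h.eval t = (∑ i ∈ Finset.range p, t ^ (i + 1)) - 1 := fun t => by
    simp [hh, eval_finsetSum]
  have on_subfield : ∀ c : F, c ≠ 0 ∧ c ^ p = c → c ^ p * h.eval (c ^ (p - 1)) = -c := by
    rintro c ⟨hc, hcp⟩
    have ht : c ^ (p - 1) = 1 := mul_left_cancel₀ hc (by rw [← pow_split, hcp, mul_one])
    simp [eval_h, ht, hcp]
  have off_subfield : ∀ c : F, ¬(c ≠ 0 ∧ c ^ p = c) →
      c ^ p * h.eval (c ^ (p - 1)) = -2 * c ^ p := by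
    intro c hc
    rcases eq_or_ne c 0 with rfl | h0
    · simp [hp.ne_zero]
    have ht : c ^ (p - 1) ≠ 1 := fun ht => hc ⟨h0, by rw [pow_split, ht, mul_one]⟩
    have ht' : (c ^ (p - 1)) ^ (p + 1) = 1 := by
      rw [← pow_mul, mul_comm, ← Nat.sq_sub_sq, one_pow, ← hF]
      exact FiniteField.pow_card_sub_one_eq_one c h0
    have hsum : ∑ i ∈ Finset.range (p + 1), (c ^ (p - 1)) ^ i = 0 := by
      rw [geom_sum_eq ht, ht', sub_self, zero_div]
    rw [Finset.sum_range_succ', pow_zero] at hsum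
    rw [eval_h, eq_neg_of_add_eq_zero_left hsum]
    ring
  have no_collision : ∀ c d : F, c ≠ 0 ∧ c ^ p = c → ¬(d ≠ 0 ∧ d ^ p = d) →
      -c ≠ -2 * d ^ p := by
    rintro c d ⟨hc, hcp⟩ hd heq
    have hc2 : c = 2 * d ^ p := by linear_combination -heq
    have hc2' : c = 2 * d := by
      rw [← hcp, hc2, mul_pow, two_pow, frob_sq]
    have hdp : d ^ p = d := mul_left_cancel₀ two_ne (hc2.symm.trans hc2')
    exact hd ⟨by rintro rfl; exact hc (by rw [hc2', mul_zero]), hdp⟩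
  refine ⟨fun c => ⟨on_subfield c, off_subfield c⟩,
    Finite.injective_iff_bijective.mp fun c d hcd => ?_⟩
  by_cases hc : c ≠ 0 ∧ c ^ p = c <;> by_cases hd : d ≠ 0 ∧ d ^ p = d
  · rw [on_subfield c hc, on_subfield d hd] at hcd
    exact neg_injective hcd
  · rw [on_subfield c hc, off_subfield d hd] at hcd
    exact absurd hcd (no_collision c d hc hd)
  · rw [off_subfield c hc, on_subfield d hd] at hcd
    exact absurd hcd.symm (no_collision d c hd hc)
  · rw [off_subfield c hc, off_subfield d hd] at hcd
    exact frob_inj c d (mul_left_cancel₀ (neg_ne_zero.mpr two_ne) hcd)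
end

section
/- Let q = 3^k with k ≥ 1 and let a be a nonzero element of the finite field F_q such that the trace Tr_{F_q/F_3}(a^{−1}) of a^{−1} from F_q to its prime field F_3 is nonzero. Then the polynomial h(X) = X³ + a·X² − a·X + 1, regarded as a polynomial over F_{q²} via the field embedding F_q → F_{q²}, is irreducible in F_{q²}[X]. -/
/-- Iterating the relation `z ^ p - z = b` in characteristic `p` telescopes. -/
theorem pow_char_pow_eq_add_sum {R : Type*} [CommRing R] (p : ℕ) [Fact p.Prime] [CharP R p]
    {z b : R} (h : z ^ p = z + b) (n : ℕ) :
    z ^ p ^ n = z + ∑ i ∈ Finset.range n, b ^ p ^ i := by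
  induction n with
  | zero => simp
  | succ n ih =>
    rw [pow_succ', pow_mul, h, add_pow_char_pow, ih, Finset.sum_range_succ, add_assoc]

open Polynomial in
theorem stmt_12 (k q : ℕ) (hk : 0 < k) (hq : q = 3 ^ k)
    (F : Type*) [Field F] [Fintype F] (hF : Fintype.card F = q)
    (E : Type*) [Field E] [Fintype E] [Algebra F E] (hE : Fintype.card E = q ^ 2)
    (a : F) (ha : a ≠ 0)
    (htr : ∑ i ∈ Finset.range k, (a⁻¹) ^ (3 ^ i) ≠ 0) :
    Irreducible (X ^ 3 + C (algebraMap F E a) * X ^ 2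
      - C (algebraMap F E a) * X + 1 : Polynomial E) := by
  subst hq
  have : Fact (Nat.Prime 3) := ⟨Nat.prime_three⟩
  have : CharP F 3 := charP_of_card_eq_prime_pow hF
  have : CharP E 3 := charP_of_injective_algebraMap (algebraMap F E).injective 3
  have h3F : (3 : F) = 0 := by exact_mod_cast CharP.cast_eq_zero F 3
  have h3 : (3 : E) = 0 := by exact_mod_cast CharP.cast_eq_zero E 3
  set c := algebraMap F E a with hc
  have hc0 : c ≠ 0 := by simpa [hc] using ha
  have hdeg : (X ^ 3 + C c * X ^ 2 - C c * X + 1 : Polynomial E).natDegree = 3 := by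
    compute_degree!
  refine (irreducible_iff_roots_eq_zero_of_degree_le_three (by lia) (by lia)).2 ?_
  refine Multiset.eq_zero_of_forall_notMem fun x hx => ?_
  have hroot : x ^ 3 + c * x ^ 2 - c * x + 1 = 0 := by
    simpa [IsRoot] using isRoot_of_mem_roots hx
  have hy : (x + 1) ^ 3 + c * (x + 1) ^ 2 - c = 0 := by
    linear_combination hroot + (x ^ 2 + x + c * x) * h3
  have hy0 : x + 1 ≠ 0 := by
    intro h
    apply hc0
    rw [h] at hy
    linear_combination -hy
  have hz : (x + 1)⁻¹ ^ 3 = (x + 1)⁻¹ + c⁻¹ := by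
    field_simp
    linear_combination -hy
  have hbF : ∀ i, (a⁻¹ ^ 3 ^ i) ^ 3 ^ k = a⁻¹ ^ 3 ^ i := fun i => by
    rw [← hF, FiniteField.pow_card]
  have hEcard := FiniteField.pow_card ((x + 1)⁻¹)
  rw [hE, ← pow_mul, mul_two, pow_char_pow_eq_add_sum 3 hz, add_eq_left, ← map_inv₀] at hEcard
  have hsum : ∑ i ∈ Finset.range (k + k), a⁻¹ ^ 3 ^ i = 0 := by
    apply (algebraMap F E).injective
    simpa using hEcard
  rw [Finset.sum_range_add] at hsum
  have hshift : ∑ i ∈ Finset.range k, a⁻¹ ^ 3 ^ (k + i) = ∑ i ∈ Finset.range k, a⁻¹ ^ 3 ^ i :=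
    Finset.sum_congr rfl fun i _ => by rw [add_comm, pow_add, pow_mul, hbF]
  rw [hshift] at hsum
  apply htr
  linear_combination (∑ i ∈ Finset.range k, a⁻¹ ^ 3 ^ i) * h3F - hsum
end

section
/- Let q = 3^k with k ≥ 1 and let a be a nonzero element of the finite field F_{q²} lying in the subfield F_q (i.e. a^q = a). Then the map c ↦ c³ + a·c^{q+2} − a·c^{2q+1} + c^{3q} is a bijection of F_{q²}. -/
/-- In characteristic three, if `σ` is an involutive ring endomorphism of a field fixing `a ≠ 0`,
then `x ↦ x³ + a x² σ(x) - a x σ(x)² + σ(x)³` is injective. -/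
theorem injective_cubic_of_involutive {F : Type*} [Field F] (h3 : (3 : F) = 0) (σ : F →+* F)
    (hσ : Function.Involutive σ) {a : F} (ha : a ≠ 0) (hσa : σ a = a) :
    Function.Injective fun x : F => x ^ 3 + a * x ^ 2 * σ x - a * x * σ x ^ 2 + σ x ^ 3 := by
  intro x u hxu
  have hf : x ^ 3 + a * x ^ 2 * σ x - a * x * σ x ^ 2 + σ x ^ 3 =
      u ^ 3 + a * u ^ 2 * σ u - a * u * σ u ^ 2 + σ u ^ 3 := hxu
  have hg := congrArg σ hf
  simp only [map_add, map_sub, map_mul, map_pow, hσa, hσ x, hσ u] at hg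
  obtain ⟨w, rfl⟩ : ∃ w, u = x - w := ⟨x - u, by ring⟩
  have hcube : (w + σ w) ^ 3 = 0 := by
    rw [map_sub] at hf hg
    generalize σ x = y at *
    generalize σ w = z at *
    grind
  have hw : σ w = -w := by
    linear_combination eq_zero_of_pow_eq_zero hcube
  have hprod : a * (w * ((x + σ x - w) * (x + σ x + w))) = 0 := by
    rw [map_sub, hw] at hf
    generalize σ x = y at *
    grind
  have hfix : σ w = w → w = 0 := by
    intro h
    linear_combination w * h3 + (hw.symm.trans h)
  have hw0 : w = 0 := by
    rcases mul_eq_zero.mp ((mul_eq_zero.mp hprod).resolve_left ha) with h | h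
    · exact h
    · apply hfix
      rcases mul_eq_zero.mp h with h | h
      · rw [← sub_eq_zero.mp h, map_add, hσ x, add_comm]
      · rw [eq_neg_of_add_eq_zero_right h, map_neg, map_add, hσ x, add_comm]
  rw [hw0, sub_zero]

theorem stmt_13 (k q : ℕ) (hk : 0 < k) (hq : q = 3 ^ k)
    (F : Type*) [Field F] [Fintype F] (hF : Fintype.card F = q ^ 2)
    (a : F) (ha : a ≠ 0) (haq : a ^ q = a) :
    Function.Bijective (fun c : F =>
      c ^ 3 + a * c ^ (q + 2) - a * c ^ (2 * q + 1) + c ^ (3 * q)) := by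
  have : Fact (Nat.Prime 3) := ⟨Nat.prime_three⟩
  have : CharP F 3 := charP_of_card_eq_prime_pow (f := k * 2) (by rw [hF, hq, pow_mul])
  have h3 : (3 : F) = 0 := by exact_mod_cast CharP.cast_eq_zero F 3
  have hσ (x : F) : iterateFrobenius F 3 k x = x ^ q := by rw [iterateFrobenius_def, hq]
  have hinv : Function.Involutive (iterateFrobenius F 3 k) := fun x => by
    rw [hσ, hσ, ← pow_mul, ← sq, ← hF, FiniteField.pow_card]
  rw [← Finite.injective_iff_bijective]
  convert injective_cubic_of_involutive h3 _ hinv ha ((hσ a).trans haq) using 2 with c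
  rw [hσ]
  ring
end

section
/- Let q = 3^k with k ≥ 1, let a be a nonzero element of the finite field F_{q²} lying in the subfield F_q (i.e. a^q = a), and let h(X) = X³ + a·X² − a·X + 1 over F_{q²}. Then for all nonzero x, y ∈ F_{q²} and every λ ∈ F_{q²} with λ^q = λ, the equality x³ · h(x^{q−1}) = λ · y³ · h(y^{q−1}) implies that there exists μ ∈ F_{q²} with μ^q = μ and x = μ·y (i.e. x/y lies in the subfield F_q). -/
/-- Over a field of characteristic three, let `u`, `v` play the role of conjugates of `x`, `y`. If the
binary cubic form `u³ + a x u² - a x² u + x³` and its conjugate at `(x, u)` are `l` times their values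
at `(y, v)`, then the determinant `w = u y - x v` equals `0` or `± (x + u) (y + v)`. -/
lemma det_mul_eq_zero_of_cubic_eq {F : Type*} [Field F] (h3 : (3 : F) = 0) {a l x y u v : F}
    (ha : a ≠ 0)
    (h : u ^ 3 + a * x * u ^ 2 - a * x ^ 2 * u + x ^ 3 =
      l * (v ^ 3 + a * y * v ^ 2 - a * y ^ 2 * v + y ^ 3))
    (h' : x ^ 3 + a * u * x ^ 2 - a * u ^ 2 * x + u ^ 3 =
      l * (y ^ 3 + a * v * y ^ 2 - a * v ^ 2 * y + v ^ 3)) :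
    (u * y - x * v) *
      ((u * y - x * v - (x + u) * (y + v)) * (u * y - x * v + (x + u) * (y + v))) = 0 := by
  have h2 : (2 : F) ≠ 0 := fun h2 => one_ne_zero (α := F) (by linear_combination h3 - h2)
  have hs : (x + u) ^ 3 = l * (y + v) ^ 3 := by
    apply mul_left_cancel₀ h2
    linear_combination h + h' + 2 * (x * u * (x + u) - l * (y * v * (y + v))) * h3
  have hd : x * u * (u - x) = l * (y * v * (v - y)) := by
    apply mul_left_cancel₀ (mul_ne_zero h2 ha)
    linear_combination h - h'
  have key : (x + u) ^ 3 * (y * v * (v - y)) = (y + v) ^ 3 * (x * u * (u - x)) := by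
    rw [hs, hd]; ring
  grind

open Polynomial in
theorem stmt_14 (k q : ℕ) (hk : 0 < k) (hq : q = 3 ^ k)
    (F : Type*) [Field F] [Fintype F] (hF : Fintype.card F = q ^ 2)
    (a : F) (ha : a ≠ 0) (haq : a ^ q = a)
    (h : Polynomial F) (hh : h = X ^ 3 + C a * X ^ 2 - C a * X + 1) :
    ∀ x y : F, x ≠ 0 → y ≠ 0 → ∀ l : F, l ^ q = l →
      x ^ 3 * h.eval (x ^ (q - 1)) = l * (y ^ 3 * h.eval (y ^ (q - 1))) →
      ∃ μ : F, μ ^ q = μ ∧ x = μ * y := by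
  intro x y _ hy l hl hxy
  have : Fact (Nat.Prime 3) := ⟨Nat.prime_three⟩
  have : CharP F 3 := charP_of_card_eq_prime_pow (f := k * 2) (by rw [hF, hq, pow_mul])
  have h3 : (3 : F) = 0 := mod_cast CharP.cast_eq_zero F 3
  have hq0 : 0 < q := hq ▸ pow_pos three_pos k
  obtain ⟨σ, hσ⟩ : ∃ σ : F →+* F, ∀ z, σ z = z ^ q :=
    ⟨iterateFrobenius F 3 k, fun z => by rw [iterateFrobenius_def, hq]⟩
  have hqq (z : F) : (z ^ q) ^ q = z := by rw [← pow_mul, ← sq, ← hF, FiniteField.pow_card]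
  have hcubic (z : F) : z ^ 3 * h.eval (z ^ (q - 1)) =
      (z ^ q) ^ 3 + a * z * (z ^ q) ^ 2 - a * z ^ 2 * z ^ q + z ^ 3 := by
    have hz : z ^ q = z * z ^ (q - 1) := (mul_pow_sub_one hq0.ne' z).symm
    simp only [hh, eval_add, eval_sub, eval_mul, eval_pow, eval_X, eval_C, eval_one]
    rw [hz]; ring
  rw [hcubic, hcubic] at hxy
  have hxy' := congrArg σ hxy
  simp only [map_add, map_sub, map_mul, map_pow] at hxy'
  simp only [hσ, hqq, haq, hl] at hxy'
  have hdet := det_mul_eq_zero_of_cubic_eq h3 ha hxy hxy'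
  have hw : x ^ q * y = x * y ^ q := by
    set w := x ^ q * y - x * y ^ q with hw_def
    set p := (x + x ^ q) * (y + y ^ q) with hp_def
    have hwq : w ^ q = -w := by
      rw [← hσ, hw_def]
      simp only [map_sub, map_mul, map_pow]
      simp only [hσ, hqq]
      ring
    have hpq : p ^ q = p := by
      rw [← hσ, hp_def]
      simp only [map_add, map_mul, map_pow]
      simp only [hσ, hqq]
      ring
    have hw0 : w = 0 := by
      rcases mul_eq_zero.mp hdet with h0 | h0
      · exact h0
      rcases mul_eq_zero.mp h0 with h0 | h0
      · have hwp : w = p := sub_eq_zero.mp h0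
        rw [← hwp, hwq] at hpq
        linear_combination w * h3 + hpq
      · have hpw : -w = p := by linear_combination -h0
        rw [← hpw, ← hσ, map_neg, hσ, hwq] at hpq
        linear_combination w * h3 - hpq
    exact sub_eq_zero.mp hw0
  refine ⟨x / y, ?_, (div_mul_cancel₀ x hy).symm⟩
  rw [div_pow, div_eq_div_iff (pow_ne_zero q hy) hy, hw]
end
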